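/- arXiv:0904.4358 — 3 statements merged into one kernel-verified Lean document; each statement's English description precedes it below -/
import Mathlib

section
/- Define f : ℝ → ℝ by f(u) = 1 − ((5+u) − √((5+u)² − 24))/4. Then for every u ∈ (0, 1] one has 0 < f(u) < u. Consequently, the sequence (θ_N) defined by θ₀ = 1 and θ_N = f(θ_{N−1}) for N ≥ 1 satisfies θ_N ∈ (0,1) for all N ≥ 1, is strictly decreasing, and converges to 0. -/
/-- The distortion-recursion map for optimal adaptive sampling of Brownian motion:
`f(u) = 1 − ((5+u) − √((5+u)² − 24))/4`. -/
noncomputable def optSamplingMap (u : ℝ) : ℝ :=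
  1 - ((5 + u) - Real.sqrt ((5 + u) ^ 2 - 24)) / 4

theorem optSamplingMap_pos {u : ℝ} (hu : 0 < u) : 0 < optSamplingMap u := by
  have h : 1 + u < Real.sqrt ((5 + u) ^ 2 - 24) := Real.lt_sqrt_of_sq_lt (by nlinarith)
  unfold optSamplingMap
  linarith

theorem optSamplingMap_lt_self {u : ℝ} (hu : 0 < u) : optSamplingMap u < u := by
  have h : Real.sqrt ((5 + u) ^ 2 - 24) < 1 + 5 * u :=
    (Real.sqrt_lt' (by linarith)).2 (by nlinarith)
  unfold optSamplingMap
  linarith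

theorem continuous_optSamplingMap : Continuous optSamplingMap := by
  unfold optSamplingMap
  fun_prop

/-- A positive orbit of a continuous map with `f u < u` for all `u > 0` tends to `0`. -/
theorem tendsto_zero_of_forall_lt_self {f : ℝ → ℝ} (hf : Continuous f)
    (hlt : ∀ u, 0 < u → f u < u) {x : ℕ → ℝ} (hpos : ∀ n, 0 < x n)
    (hx : ∀ n, x (n + 1) = f (x n)) : Filter.Tendsto x Filter.atTop (nhds 0) := by
  have hanti : Antitone x := antitone_nat_of_succ_le fun n => by
    rw [hx]
    exact (hlt _ (hpos n)).le
  have hlim : Filter.Tendsto x Filter.atTop (nhds (⨅ n, x n)) :=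
    tendsto_atTop_ciInf hanti ⟨0, by rintro _ ⟨n, rfl⟩; exact (hpos n).le⟩
  have hfix : f (⨅ n, x n) = ⨅ n, x n := by
    have hsucc := hlim.comp (Filter.tendsto_add_atTop_nat 1)
    refine tendsto_nhds_unique ((hf.tendsto _).comp hlim) (hsucc.congr fun n => ?_)
    exact hx n
  rcases (le_ciInf fun n => (hpos n).le : 0 ≤ ⨅ n, x n).eq_or_lt with h | h
  · rwa [← h] at hlim
  · exact absurd hfix (hlt _ h).ne

/-- **Optimal-sampling distortion recursion for Brownian motion.**
For every `u ∈ (0,1]` one has `0 < f(u) < u`, where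
`f(u) = 1 − ((5+u) − √((5+u)² − 24))/4`.  Consequently the sequence `θ₀ = 1`,
`θ_N = f(θ_{N−1})` satisfies `θ_N ∈ (0,1)` for all `N ≥ 1`, is strictly decreasing,
and converges to `0`. -/
theorem optSampling_distortion_recursion :
    (∀ u : ℝ, 0 < u → u ≤ 1 → 0 < optSamplingMap u ∧ optSamplingMap u < u) ∧
    ∀ θ : ℕ → ℝ, θ 0 = 1 → (∀ N : ℕ, 1 ≤ N → θ N = optSamplingMap (θ (N - 1))) →
      (∀ N : ℕ, 1 ≤ N → 0 < θ N ∧ θ N < 1) ∧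
      StrictAnti θ ∧
      Filter.Tendsto θ Filter.atTop (nhds 0) := by
  refine ⟨fun u hu _ => ⟨optSamplingMap_pos hu, optSamplingMap_lt_self hu⟩, fun θ h0 hθ => ?_⟩
  have hsucc (n : ℕ) : θ (n + 1) = optSamplingMap (θ n) := hθ (n + 1) (Nat.le_add_left 1 n)
  have hpos (n : ℕ) : 0 < θ n := by
    induction n with
    | zero => rw [h0]; exact one_pos
    | succ n ih => rw [hsucc]; exact optSamplingMap_pos ih
  have hanti : StrictAnti θ := strictAnti_nat_of_succ_lt fun n => by
    rw [hsucc]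
    exact optSamplingMap_lt_self (hpos n)
  exact ⟨fun N hN => ⟨hpos N, h0 ▸ hanti hN⟩, hanti,
    tendsto_zero_of_forall_lt_self continuous_optSamplingMap (fun _ => optSamplingMap_lt_self)
      hpos hsucc⟩
end

section
/- Let T > 0, β ∈ [0,1], and set A = ((5+β) − √((5+β)² − 24))/4. Define g(x,t) = A[(T−t)² + 2x²(T−t) + x⁴/3] for x ∈ ℝ and t ≤ T. Then: (i) g satisfies the heat equation ∂_t g + (1/2)∂²_{xx} g = 0 on ℝ × (−∞, T]; (ii) for all x ∈ ℝ and t ≤ T, g(x,t) − 2x²(T−t) − (1−β)(T−t)² = (A/3)·(x² − √(3(A−1+β)/A)·(T−t))², which is nonnegative; in particular g(x,t) ≥ 2x²(T−t) + (1−β)(T−t)², with equality exactly when x² = √(3(A−1+β)/A)·(T−t). -/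
theorem quadratic_eq_zero_of_eq_smaller_root {β A : ℝ} (hβ : 0 ≤ β)
    (hA : A = ((5 + β) - Real.sqrt ((5 + β) ^ 2 - 24)) / 4) :
    2 * A ^ 2 - (5 + β) * A + 3 = 0 := by
  have hsq : Real.sqrt ((5 + β) ^ 2 - 24) ^ 2 = (5 + β) ^ 2 - 24 :=
    Real.sq_sqrt (by nlinarith)
  rw [hA]
  linear_combination hsq / 8

theorem smaller_root_pos {β A : ℝ} (hβ : 0 ≤ β)
    (hA : A = ((5 + β) - Real.sqrt ((5 + β) ^ 2 - 24)) / 4) : 0 < A := by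
  have h : Real.sqrt ((5 + β) ^ 2 - 24) < 5 + β :=
    (Real.sqrt_lt' (by linarith)).2 (by linarith)
  linarith

theorem smaller_root_le_one {β A : ℝ} (hβ : 0 ≤ β)
    (hA : A = ((5 + β) - Real.sqrt ((5 + β) ^ 2 - 24)) / 4) : A ≤ 1 := by
  have h : 1 + β ≤ Real.sqrt ((5 + β) ^ 2 - 24) := Real.le_sqrt_of_sq_le (by nlinarith)
  linarith

theorem sqrt_ratio_eq_of_quadratic {β A : ℝ} (hpos : 0 < A) (hle : A ≤ 1)
    (hquad : 2 * A ^ 2 - (5 + β) * A + 3 = 0) :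
    Real.sqrt (3 * (A - 1 + β) / A) = 3 * (1 - A) / A := by
  have hnonneg : 0 ≤ 3 * (1 - A) / A := div_nonneg (by linarith) hpos.le
  rw [← Real.sqrt_sq hnonneg]
  congr 1
  field_simp
  linear_combination (-1 : ℝ) * hquad

theorem heat_polynomial_satisfies_backward_heat_equation (A T x t : ℝ) :
    deriv (fun s => A * ((T - s) ^ 2 + 2 * x ^ 2 * (T - s) + x ^ 4 / 3)) t +
      (1 / 2) * deriv (deriv (fun y =>
        A * ((T - t) ^ 2 + 2 * y ^ 2 * (T - t) + y ^ 4 / 3))) x = 0 := by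
  have ht : HasDerivAt (fun s => A * ((T - s) ^ 2 + 2 * x ^ 2 * (T - s) + x ^ 4 / 3))
      (A * (-2 * (T - t) - 2 * x ^ 2)) t := by
    have h := (hasDerivAt_id' t).const_sub T
    refine ((((h.pow 2).add (h.const_mul (2 * x ^ 2))).add_const
      (x ^ 4 / 3)).const_mul A).congr_deriv ?_
    push_cast
    ring
  have hx : deriv (fun y => A * ((T - t) ^ 2 + 2 * y ^ 2 * (T - t) + y ^ 4 / 3)) =
      fun y => A * (4 * y * (T - t) + 4 * y ^ 3 / 3) := by
    funext y
    apply HasDerivAt.deriv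
    refine ((((((hasDerivAt_pow 2 y).const_mul 2).mul_const (T - t)).const_add
      ((T - t) ^ 2)).add ((hasDerivAt_pow 4 y).div_const 3)).const_mul A).congr_deriv ?_
    push_cast
    ring
  have hxx : HasDerivAt (fun y => A * (4 * y * (T - t) + 4 * y ^ 3 / 3))
      (A * (4 * (T - t) + 4 * x ^ 2)) x := by
    refine (((((hasDerivAt_id' x).const_mul 4).mul_const (T - t)).add
      (((hasDerivAt_pow 3 x).const_mul 4).div_const 3)).const_mul A).congr_deriv ?_
    push_cast
    ring
  rw [ht.deriv, hx, hxx.deriv]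
  ring

/-- **Explicit solution of the free-boundary PDE for optimal sampling of Brownian motion.**
Let `T > 0`, `β ∈ [0,1]`, and `A = ((5+β) − √((5+β)² − 24))/4`.  With
`g(x,t) = A[(T−t)² + 2x²(T−t) + x⁴/3]` one has:
(i) `∂_t g + (1/2)∂²_{xx} g = 0` on `ℝ × (−∞, T]`;
(ii) for all `x ∈ ℝ`, `t ≤ T`,
`g(x,t) − 2x²(T−t) − (1−β)(T−t)² = (A/3)(x² − √(3(A−1+β)/A)(T−t))² ≥ 0`;
in particular `g(x,t) ≥ 2x²(T−t) + (1−β)(T−t)²`, with equality exactly when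
`x² = √(3(A−1+β)/A)(T−t)`. -/
theorem snell_free_boundary_solution
    (T : ℝ) (hT : 0 < T) (β : ℝ) (hβ : β ∈ Set.Icc (0 : ℝ) 1)
    (A : ℝ) (hA : A = ((5 + β) - Real.sqrt ((5 + β) ^ 2 - 24)) / 4)
    (g : ℝ → ℝ → ℝ)
    (hg : ∀ x t : ℝ, g x t = A * ((T - t) ^ 2 + 2 * x ^ 2 * (T - t) + x ^ 4 / 3)) :
    (∀ (x t : ℝ), t ≤ T →
      deriv (fun s => g x s) t + (1 / 2) * deriv (deriv (fun y => g y t)) x = 0) ∧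
    (∀ (x t : ℝ), t ≤ T →
      g x t - 2 * x ^ 2 * (T - t) - (1 - β) * (T - t) ^ 2
        = (A / 3) * (x ^ 2 - Real.sqrt (3 * (A - 1 + β) / A) * (T - t)) ^ 2 ∧
      0 ≤ g x t - 2 * x ^ 2 * (T - t) - (1 - β) * (T - t) ^ 2) ∧
    (∀ (x t : ℝ), t ≤ T →
      (g x t = 2 * x ^ 2 * (T - t) + (1 - β) * (T - t) ^ 2 ↔
        x ^ 2 = Real.sqrt (3 * (A - 1 + β) / A) * (T - t))) := by
  have hquad := quadratic_eq_zero_of_eq_smaller_root hβ.1 hA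
  have hpos := smaller_root_pos hβ.1 hA
  have hsqrt := sqrt_ratio_eq_of_quadratic hpos (smaller_root_le_one hβ.1 hA) hquad
  have hsquare : ∀ x t : ℝ, g x t - 2 * x ^ 2 * (T - t) - (1 - β) * (T - t) ^ 2
      = (A / 3) * (x ^ 2 - Real.sqrt (3 * (A - 1 + β) / A) * (T - t)) ^ 2 := by
    intro x t
    rw [hg, hsqrt]
    field_simp
    linear_combination (-3 * (T - t) ^ 2) * hquad
  refine ⟨fun x t _ => ?_, fun x t _ => ⟨hsquare x t, ?_⟩, fun x t _ => ?_⟩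
  · simp only [hg]
    exact heat_polynomial_satisfies_backward_heat_equation A T x t
  · rw [hsquare]
    positivity
  · have hA3 : A / 3 ≠ 0 := by positivity
    rw [← sub_eq_zero, ← sub_sub, hsquare, mul_eq_zero, or_iff_right hA3,
      sq_eq_zero_iff, sub_eq_zero]
end

section
/- Let a ≠ 0, δ > 0, M ∈ ℕ, and set ρ = e^{aδ}, σ² = (e^{2aδ} − 1)/(2a) > 0, and g_n = (e^{2aδ(M−n)} − 1)/(2a) ≥ 0 for n = 0, …, M. Define functions V_n : ℝ → ℝ backwards by V_M(x) = 0 and, for n = M−1, …, 0, V_n(x) = max{ g_n x², E[V_{n+1}(ρx + W)] }, where W is a centered Gaussian random variable with variance σ². Then every V_n is an even function of x, and for every n ∈ {0, …, M} there exists a threshold λ_n ∈ [0, ∞] such that the stopping set { x ∈ ℝ : g_n x² ≥ E[V_{n+1}(ρx + W)] } equals { x ∈ ℝ : |x| ≥ λ_n }. -/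
open MeasureTheory ProbabilityTheory

/-- The Gaussian convolution of a nonnegative continuous function that decreases in `|x|` again
decreases in `|x|`. -/
theorem integral_add_gaussianReal_le_of_abs_le {v : NNReal} (hv : v ≠ 0) {f : ℝ → ℝ}
    (hf : Continuous f) (hf0 : ∀ x, 0 ≤ f x) (hanti : ∀ x y, |x| ≤ |y| → f y ≤ f x)
    {x y : ℝ} (hxy : |x| ≤ |y|) :
    ∫ w, f (y + w) ∂(gaussianReal 0 v) ≤ ∫ w, f (x + w) ∂(gaussianReal 0 v) := by
  set p : ℝ → ℝ := gaussianPDFReal 0 v with hp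
  have heven : ∀ u, f (-u) = f u := fun u =>
    le_antisymm (hanti _ _ (abs_neg u).ge) (hanti _ _ (abs_neg u).le)
  have hbound : ∀ u, ‖f u‖ ≤ f 0 := fun u => by
    rw [Real.norm_of_nonneg (hf0 u)]
    exact hanti 0 u (by simp)
  have hpint : Integrable p := integrable_gaussianPDFReal 0 v
  have hmul : ∀ z : ℝ, ∀ q : ℝ → ℝ, Integrable q → Integrable fun w => q w * f (z + w) :=
    fun z q hq => hq.mul_bdd (c := f 0)
      (hf.comp (continuous_const.add continuous_id)).aestronglyMeasurable
      (Filter.Eventually.of_forall fun w => hbound _)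
  have hqint : Integrable fun w => p (-(x + y) - w) := hpint.comp_sub_left (-(x + y))
  have hpmono : ∀ u w : ℝ, u ^ 2 ≤ w ^ 2 → p w ≤ p u := fun u w h => by
    simp only [hp, gaussianPDFReal, sub_zero]
    gcongr
  have hreflx : ∫ w, p (-(x + y) - w) * f (x + w) = ∫ w, p w * f (y + w) := by
    rw [← integral_sub_left_eq_self (fun w => p w * f (y + w)) volume (-(x + y))]
    congr 1 with w
    rw [← heven (x + w)]
    ring_nf
  have hrefly : ∫ w, p (-(x + y) - w) * f (y + w) = ∫ w, p w * f (x + w) := by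
    rw [← integral_sub_left_eq_self (fun w => p w * f (x + w)) volume (-(x + y))]
    congr 1 with w
    rw [← heven (y + w)]
    ring_nf
  have hpos : 0 ≤ ∫ w, ((p w * f (x + w) - p w * f (y + w)) -
      (p (-(x + y) - w) * f (x + w) - p (-(x + y) - w) * f (y + w))) := by
    refine integral_nonneg fun w => ?_
    have key : 0 ≤ (p w - p (-(x + y) - w)) * (f (x + w) - f (y + w)) := by
      have hcase : (0 ≤ y - x ∧ 0 ≤ x + y) ∨ (y - x ≤ 0 ∧ x + y ≤ 0) := by
        rcases abs_cases x with h | h <;> rcases abs_cases y with h' | h' <;>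
          first
          | (left; constructor <;> linarith)
          | (right; constructor <;> linarith)
      rcases hcase with ⟨h1, h2⟩ | ⟨h1, h2⟩ <;>
        rcases le_total 0 (x + y + 2 * w) with h3 | h3 <;>
        first
        | exact mul_nonneg
            (sub_nonneg.2 (hpmono _ _ (by nlinarith)))
            (sub_nonneg.2 (hanti _ _ (sq_le_sq.1 (by nlinarith))))
        | exact mul_nonneg_of_nonpos_of_nonpos
            (sub_nonpos.2 (hpmono _ _ (by nlinarith)))
            (sub_nonpos.2 (hanti _ _ (sq_le_sq.1 (by nlinarith))))
    simp only [Pi.zero_apply]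
    linarith
  have hp_diff : Integrable fun w => p w * f (x + w) - p w * f (y + w) :=
    (hmul x p hpint).sub (hmul y p hpint)
  have hq_diff : Integrable fun w =>
      p (-(x + y) - w) * f (x + w) - p (-(x + y) - w) * f (y + w) :=
    (hmul x _ hqint).sub (hmul y _ hqint)
  rw [integral_sub hp_diff hq_diff,
    integral_sub (hmul x p hpint) (hmul y p hpint),
    integral_sub (hmul x _ hqint) (hmul y _ hqint), hreflx, hrefly] at hpos
  simp only [integral_gaussianReal_eq_integral_smul hv, smul_eq_mul]
  linarith

/-- A closed sublevel set of a continuous function that decreases in `|x|` is the complement of a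
(possibly empty or full) open symmetric interval. -/
theorem exists_threshold_of_continuous_of_abs_antitone {h : ℝ → ℝ} (hc : Continuous h)
    (hanti : ∀ x y, |x| ≤ |y| → h y ≤ h x) :
    ∃ lam : ENNReal, {x : ℝ | h x ≤ 0} = {x : ℝ | lam ≤ ENNReal.ofReal |x|} := by
  set S : Set ℝ := {r | 0 ≤ r ∧ h r ≤ 0} with hS
  have habs : ∀ x, h x ≤ 0 → |x| ∈ S := fun x hx =>
    ⟨abs_nonneg x, (hanti x |x| (abs_abs x).ge).trans hx⟩
  rcases S.eq_empty_or_nonempty with hemp | hne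
  · refine ⟨⊤, Set.ext fun x => ?_⟩
    simp only [Set.mem_ofPred_eq, top_le_iff, ENNReal.ofReal_ne_top, iff_false]
    intro hx
    simpa [hemp] using habs x hx
  · have hbdd : BddBelow S := ⟨0, fun r hr => hr.1⟩
    have hclosed : IsClosed S :=
      (isClosed_le continuous_const continuous_id).inter (isClosed_le hc continuous_const)
    have hmem : sInf S ∈ S := hclosed.csInf_mem hne hbdd
    refine ⟨ENNReal.ofReal (sInf S), Set.ext fun x => ?_⟩
    simp only [Set.mem_ofPred_eq]
    rw [ENNReal.ofReal_le_ofReal_iff (abs_nonneg x)]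
    refine ⟨fun hx => csInf_le hbdd (habs x hx), fun hx => ?_⟩
    exact (hanti (sInf S) x (by rwa [abs_of_nonneg hmem.1])).trans hmem.2

theorem exp_sub_one_div_pos {b t : ℝ} (hb : b ≠ 0) (ht : 0 < t) :
    0 < (Real.exp (b * t) - 1) / b := by
  rcases hb.lt_or_gt with h | h
  · exact div_pos_of_neg_of_neg
      (sub_neg.2 (Real.exp_lt_one_iff.2 (mul_neg_of_neg_of_pos h ht))) h
  · exact div_pos (sub_pos.2 (Real.one_lt_exp_iff.2 (mul_pos h ht))) h

theorem integrable_add_sq_gaussianReal (v : NNReal) (c : ℝ) :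
    Integrable (fun w => (c + w) ^ 2) (gaussianReal 0 v) := by
  have h : MemLp (fun w : ℝ => c + w) 2 (gaussianReal 0 v) :=
    (memLp_const c).add (memLp_id_gaussianReal 2)
  exact h.integrable_sq

theorem integral_add_sq_gaussianReal (v : NNReal) (c : ℝ) :
    ∫ w, (c + w) ^ 2 ∂(gaussianReal 0 v) = c ^ 2 + v := by
  have hid : MemLp (fun w : ℝ => w) 2 (gaussianReal 0 v) := memLp_id_gaussianReal 2
  have h1 : Integrable (fun w : ℝ => w) (gaussianReal 0 v) := hid.integrable (by norm_num)
  have h2 : Integrable (fun w : ℝ => w ^ 2) (gaussianReal 0 v) := hid.integrable_sq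
  have hmean : ∫ w : ℝ, w ∂(gaussianReal 0 v) = 0 := integral_id_gaussianReal
  have hsq : ∫ w : ℝ, w ^ 2 ∂(gaussianReal 0 v) = v := by
    have := variance_fun_id_gaussianReal (μ := 0) (v := v)
    rwa [variance_of_integral_eq_zero aemeasurable_id' hmean] at this
  have hexp : ∀ w : ℝ, (c + w) ^ 2 = (c ^ 2 + 2 * c * w) + w ^ 2 := fun w => by ring
  have h3 : Integrable (fun w : ℝ => c ^ 2 + 2 * c * w) (gaussianReal 0 v) :=
    (integrable_const _).add (h1.const_mul _)
  simp_rw [hexp]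
  rw [integral_add h3 h2,
    integral_add (integrable_const _) (h1.const_mul _), integral_const_mul, hmean, hsq]
  simp

/-- **Threshold structure of the discrete-time dynamic program for sampling an
Ornstein–Uhlenbeck process.**  Let `a ≠ 0`, `δ > 0`, `M ∈ ℕ`, `ρ = e^{aδ}`,
`σ² = (e^{2aδ} − 1)/(2a) > 0`, and `g_n = (e^{2aδ(M−n)} − 1)/(2a) ≥ 0` for `n ≤ M`.
Define `V_M(x) = 0` (and `V_n = 0` for `n ≥ M`) and, backwards for `n < M`,
`V_n(x) = max{g_n x², E[V_{n+1}(ρx + W)]}` with `W ∼ N(0, σ²)`.  Then `σ² > 0`, each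
`g_n ≥ 0`, every `V_n` is even, and for every `n ∈ {0, …, M}` there is a threshold
`λ_n ∈ [0, ∞]` such that the stopping set `{x : g_n x² ≥ E[V_{n+1}(ρx + W)]}` equals
`{x : |x| ≥ λ_n}`. -/
theorem ou_discrete_dp_threshold_structure
    (a : ℝ) (ha : a ≠ 0) (δ : ℝ) (hδ : 0 < δ) (M : ℕ)
    (ρ : ℝ) (hρ : ρ = Real.exp (a * δ))
    (σ2 : ℝ) (hσ2 : σ2 = (Real.exp (2 * a * δ) - 1) / (2 * a))
    (g : ℕ → ℝ) (hg : ∀ n : ℕ, n ≤ M →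
      g n = (Real.exp (2 * a * δ * ((M : ℝ) - (n : ℝ))) - 1) / (2 * a))
    (V : ℕ → ℝ → ℝ)
    (hVM : ∀ n : ℕ, M ≤ n → ∀ x : ℝ, V n x = 0)
    (hVrec : ∀ n : ℕ, n < M → ∀ x : ℝ,
      V n x = max (g n * x ^ 2)
        (∫ w, V (n + 1) (ρ * x + w) ∂(gaussianReal 0 σ2.toNNReal))) :
    0 < σ2 ∧
    (∀ n : ℕ, n ≤ M → 0 ≤ g n) ∧
    (∀ n : ℕ, n ≤ M → ∀ x : ℝ, V n x = V n (-x)) ∧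
    (∀ n : ℕ, n ≤ M → ∃ lam : ENNReal,
      {x : ℝ | (∫ w, V (n + 1) (ρ * x + w) ∂(gaussianReal 0 σ2.toNNReal))
          ≤ g n * x ^ 2}
        = {x : ℝ | lam ≤ ENNReal.ofReal |x|}) := by
  have hσpos : 0 < σ2 := by
    rw [hσ2]
    exact exp_sub_one_div_pos (mul_ne_zero two_ne_zero ha) hδ
  have hgnonneg : ∀ n : ℕ, n ≤ M → 0 ≤ g n := fun n hn => by
    rw [hg n hn]
    rcases hn.eq_or_lt with rfl | hlt
    · simp
    · have hMn : (0 : ℝ) < M - n := sub_pos.2 (by exact_mod_cast hlt)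
      rw [mul_assoc (2 * a) δ]
      exact (exp_sub_one_div_pos (mul_ne_zero two_ne_zero ha) (mul_pos hδ hMn)).le
  have hv : σ2.toNNReal ≠ 0 := (Real.toNNReal_pos.2 hσpos).ne'
  have hgM : g M = 0 := by rw [hg M le_rfl]; simp
  have hgrec : ∀ n : ℕ, n < M → g (n + 1) * ρ ^ 2 = g n - σ2 := fun n hn => by
    have hexp : Real.exp (2 * a * δ * ((M : ℝ) - n)) =
        Real.exp (2 * a * δ * ((M : ℝ) - (n + 1))) * Real.exp (2 * a * δ) := by
      rw [← Real.exp_add]; ring_nf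
    have hρ2 : ρ ^ 2 = Real.exp (2 * a * δ) := by
      rw [hρ, ← Real.exp_nat_mul]; push_cast; ring_nf
    rw [hg n hn.le, hg (n + 1) hn, hσ2, hρ2, Nat.cast_succ, hexp]
    ring
  set μ := gaussianReal 0 σ2.toNNReal with hμ
  set h : ℕ → ℝ → ℝ := fun n x => (∫ w, V (n + 1) (ρ * x + w) ∂μ) - g n * x ^ 2 with hh
  have hhM : ∀ x, h M x = 0 := fun x => by simp [hh, hgM, hVM (M + 1) (Nat.le_succ M)]
  have hV : ∀ n : ℕ, n ≤ M → ∀ x, V n x = g n * x ^ 2 + max (h n x) 0 := fun n hn x => by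
    rcases hn.eq_or_lt with rfl | hlt
    · simp [hhM, hgM, hVM n le_rfl]
    · rw [hVrec n hlt x, max_comm, ← max_add_add_left]
      simp [hh]
  have hmain : ∀ n : ℕ, n ≤ M →
      Continuous (h n) ∧ ∀ x y, |x| ≤ |y| → h n y ≤ h n x := fun n hn => by
    induction hn using Nat.decreasingInduction with
    | self =>
      rw [show h M = fun _ => 0 from funext hhM]
      exact ⟨continuous_const, fun _ _ _ => le_rfl⟩
    | of_succ n hn ih =>
      obtain ⟨hcont, hanti⟩ := ih
      set f : ℝ → ℝ := fun x => max (h (n + 1) x) 0 with hf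
      have hfcont : Continuous f := hcont.max continuous_const
      have hf0 : ∀ x, 0 ≤ f x := fun x => le_max_right _ _
      have hfanti : ∀ x y, |x| ≤ |y| → f y ≤ f x := fun x y hxy =>
        max_le_max_right 0 (hanti x y hxy)
      have hfbound : ∀ x, ‖f x‖ ≤ f 0 := fun x => by
        rw [Real.norm_of_nonneg (hf0 x)]
        exact hfanti 0 x (by simp)
      have hfint : ∀ c, Integrable (fun w => f (c + w)) μ := fun c =>
        Integrable.of_bound
          (hfcont.comp (continuous_const.add continuous_id)).aestronglyMeasurable (f 0)
          (Filter.Eventually.of_forall fun w => hfbound _)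
      have hstep : ∀ x, h n x =
          g (n + 1) * σ2 - σ2 * x ^ 2 + ∫ w, f (ρ * x + w) ∂μ := fun x => by
        simp only [hh, hV (n + 1) hn]
        rw [integral_add ((integrable_add_sq_gaussianReal _ _).const_mul _) (hfint _),
          integral_const_mul, integral_add_sq_gaussianReal, Real.coe_toNNReal _ hσpos.le]
        linear_combination x ^ 2 * hgrec n hn
      constructor
      · rw [show h n = _ from funext hstep]
        refine Continuous.add (by fun_prop) ?_
        refine continuous_of_dominated (bound := fun _ => f 0) (fun x => (hfint _).1)
          (fun x => Filter.Eventually.of_forall fun w => hfbound _) (integrable_const _)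
          (Filter.Eventually.of_forall fun w => ?_)
        exact hfcont.comp (by fun_prop)
      · intro x y hxy
        rw [hstep, hstep]
        have hconv : ∫ w, f (ρ * y + w) ∂μ ≤ ∫ w, f (ρ * x + w) ∂μ :=
          integral_add_gaussianReal_le_of_abs_le hv hfcont hf0 hfanti
            (by rw [abs_mul, abs_mul]; gcongr)
        have hsq := mul_le_mul_of_nonneg_left (sq_le_sq.2 hxy) hσpos.le
        linarith
  refine ⟨hσpos, hgnonneg, fun n hn x => ?_, fun n hn => ?_⟩
  · have heven : h n x = h n (-x) :=
      le_antisymm ((hmain n hn).2 _ _ (abs_neg x).le) ((hmain n hn).2 _ _ (abs_neg x).ge)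
    rw [hV n hn, hV n hn, heven, neg_sq]
  · obtain ⟨lam, hlam⟩ :=
      exists_threshold_of_continuous_of_abs_antitone (hmain n hn).1 (hmain n hn).2
    refine ⟨lam, ?_⟩
    rw [← hlam]
    simp [hh]
end
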